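/- For linear observation maps G(x;d) = G(d)x, G_N(x;d) = G_N(d)x from a separable Hilbert space X to ℝ^p and Gaussian prior μ₀ = N(0, C₀) with Gaussian noise N(0,Γ), the prior-averaged KL divergence between the two likelihoods equals the squared Hilbert–Schmidt norm: E^{μ₀} D_KL(π_N(·|X;d) ∥ π(·|X;d)) = (1/2)‖Γ^{-1/2}(G(d) − G_N(d)) C₀^{1/2}‖²_{HS}. -/

import Mathlib

open MeasureTheory Matrix ProbabilityTheory
open scoped RealInnerProductSpace

/-- Density of the multivariate normal distribution `N(m, Γ)` on `ℝ^p`. -/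
noncomputable def gaussDensity (p : ℕ) (Γ : Matrix (Fin p) (Fin p) ℝ)
    (m : Fin p → ℝ) (y : Fin p → ℝ) : ℝ :=
  (Real.sqrt ((2 * Real.pi) ^ p * Γ.det))⁻¹ *
    Real.exp (-(1 / 2) * ((y - m) ⬝ᵥ Γ⁻¹.mulVec (y - m)))

open scoped MatrixOrder Matrix.Norms.L2Operator in
lemma aux_factor {p : ℕ} {P : Matrix (Fin p) (Fin p) ℝ} (hP : P.PosDef) :
    ∃ B : Matrix (Fin p) (Fin p) ℝ, P = Bᵀ * B := by
  obtain ⟨B, hB⟩ := CStarAlgebra.nonneg_iff_eq_star_mul_self.mp hP.posSemidef.nonneg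
  refine ⟨B, ?_⟩
  rw [hB, Matrix.star_eq_conjTranspose, Matrix.conjTranspose_eq_transpose_of_trivial]

lemma aux_bilin {p : ℕ} (B : Matrix (Fin p) (Fin p) ℝ) (v w : Fin p → ℝ) :
    v ⬝ᵥ (Bᵀ * B).mulVec w = (B.mulVec v) ⬝ᵥ (B.mulVec w) := by
  rw [← Matrix.mulVec_mulVec, Matrix.dotProduct_mulVec, Matrix.vecMul_transpose]

lemma aux_exp_prod {p : ℕ} (w : Fin p → ℝ) :
    Real.exp (-(1 / 2) * (w ⬝ᵥ w)) = ∏ i, Real.exp (-(1 / 2) * (w i) ^ 2) := by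
  rw [← Real.exp_sum, dotProduct, Finset.mul_sum]
  congr 1
  exact Finset.sum_congr rfl fun i _ => by ring

lemma aux_int0 (p : ℕ) :
    Integrable (fun w : Fin p → ℝ => Real.exp (-(1 / 2) * (w ⬝ᵥ w))) := by
  simp_rw [aux_exp_prod]
  exact Integrable.fintype_prod (f := fun _ x => Real.exp (-(1 / 2) * x ^ 2))
    (fun _ => integrable_exp_neg_mul_sq (by norm_num))

lemma aux_val0 (p : ℕ) :
    ∫ w : Fin p → ℝ, Real.exp (-(1 / 2) * (w ⬝ᵥ w)) = Real.sqrt (2 * Real.pi) ^ p := by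
  simp_rw [aux_exp_prod]
  rw [integral_fintype_prod_volume_eq_pow (fun x : ℝ => Real.exp (-(1 / 2) * x ^ 2)),
    integral_gaussian, Fintype.card_fin]
  congr 2
  ring

lemma aux_int1 {p : ℕ} (i : Fin p) :
    Integrable (fun w : Fin p → ℝ => w i * Real.exp (-(1 / 2) * (w ⬝ᵥ w))) := by
  have h : ∀ w : Fin p → ℝ, w i * Real.exp (-(1 / 2) * (w ⬝ᵥ w)) =
      ∏ j, ((if j = i then w j else 1) * Real.exp (-(1 / 2) * (w j) ^ 2)) := by
    intro w
    rw [aux_exp_prod, Finset.prod_mul_distrib]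
    simp
  simp_rw [h]
  refine Integrable.fintype_prod
    (f := fun j x => (if j = i then x else 1) * Real.exp (-(1 / 2) * x ^ 2)) (fun j => ?_)
  by_cases hj : j = i
  · simp only [hj, if_true]
    exact integrable_mul_exp_neg_mul_sq (by norm_num)
  · simp only [hj, if_false, one_mul]
    exact integrable_exp_neg_mul_sq (by norm_num)

lemma aux_int2 {p : ℕ} (a : Fin p → ℝ) :
    Integrable (fun w : Fin p → ℝ => (a ⬝ᵥ w) * Real.exp (-(1 / 2) * (w ⬝ᵥ w))) := by
  simp_rw [dotProduct.eq_1 a, Finset.sum_mul, mul_assoc]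
  exact integrable_finsetSum _ fun i _ => (aux_int1 i).const_mul _

lemma aux_val2 {p : ℕ} (a : Fin p → ℝ) :
    ∫ w : Fin p → ℝ, (a ⬝ᵥ w) * Real.exp (-(1 / 2) * (w ⬝ᵥ w)) = 0 := by
  have h := integral_neg_eq_self
    (fun w : Fin p → ℝ => (a ⬝ᵥ w) * Real.exp (-(1 / 2) * (w ⬝ᵥ w))) volume
  simp only [dotProduct_neg, neg_dotProduct, neg_neg, neg_mul, integral_neg] at h ⊢
  linarith

lemma aux_val {p : ℕ} (a : Fin p → ℝ) (c : ℝ) :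
    ∫ w : Fin p → ℝ, ((a ⬝ᵥ w) + c) * Real.exp (-(1 / 2) * (w ⬝ᵥ w))
      = c * Real.sqrt (2 * Real.pi) ^ p := by
  simp_rw [add_mul]
  rw [integral_add (aux_int2 a) ((aux_int0 p).const_mul c), aux_val2, integral_const_mul,
    aux_val0, zero_add]

lemma aux_cov {p : ℕ} {B : Matrix (Fin p) (Fin p) ℝ} (hB : B.det ≠ 0) (f : (Fin p → ℝ) → ℝ)
    (hf : Continuous f) :
    ∫ z, f (B.mulVec z) = |B.det|⁻¹ * ∫ w, f w := by
  have h := Real.map_matrix_volume_pi_eq_smul_volume_pi hB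
  have h2 : ∫ w, f w ∂(Measure.map (toLin' B) volume) = ∫ z, f (B.mulVec z) := by
    rw [integral_map]
    · simp
    · exact (LinearMap.continuous_of_finiteDimensional _).aemeasurable
    · exact hf.aestronglyMeasurable
  rw [← h2, h, integral_smul_measure, ENNReal.toReal_ofReal (abs_nonneg _), abs_inv, smul_eq_mul]

lemma aux_kl {p : ℕ} {Γ B : Matrix (Fin p) (Fin p) ℝ} (hΓ : Γ.PosDef) (hB : Γ⁻¹ = Bᵀ * B)
    (m n : Fin p → ℝ) :
    (∫ y, Real.log (gaussDensity p Γ m y / gaussDensity p Γ n y) * gaussDensity p Γ m y)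
      = (1 / 2) * (B.mulVec (n - m) ⬝ᵥ B.mulVec (n - m)) := by
  have hdet : 0 < Γ.det := hΓ.det_pos
  have hBd : Γ.det⁻¹ = B.det ^ 2 := by
    have := congrArg Matrix.det hB
    rw [Matrix.det_nonsing_inv, Matrix.det_mul, Matrix.det_transpose,
      Ring.inverse_eq_inv'] at this
    rw [this]; ring
  have hB0 : B.det ≠ 0 := by
    intro h
    rw [h] at hBd
    have : 0 < Γ.det⁻¹ := inv_pos.mpr hdet
    simp [hBd] at this
  set K := (Real.sqrt ((2 * Real.pi) ^ p * Γ.det))⁻¹ with hK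
  have hKpos : 0 < K := by rw [hK]; have := Real.pi_pos; positivity
  have hKval : K * (|B.det|⁻¹ * Real.sqrt (2 * Real.pi) ^ p) = 1 := by
    have e1 : Real.sqrt ((2 * Real.pi) ^ p * Γ.det) = |B.det|⁻¹ * Real.sqrt (2 * Real.pi) ^ p := by
      have hG : Γ.det = (|B.det|⁻¹) ^ 2 := by
        rw [inv_pow, sq_abs, ← hBd, inv_inv]
      have h2 : (2 * Real.pi) ^ p = (Real.sqrt (2 * Real.pi) ^ p) ^ 2 := by
        rw [← pow_mul, mul_comm p 2, pow_mul, Real.sq_sqrt (by have := Real.pi_pos; positivity)]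
      rw [hG, h2, ← mul_pow, Real.sqrt_sq (by positivity), mul_comm]
    rw [← e1, hK]
    apply inv_mul_cancel₀
    have := Real.pi_pos
    positivity
  set a := B.mulVec (m - n) with ha
  have key : ∀ y, Real.log (gaussDensity p Γ m y / gaussDensity p Γ n y) * gaussDensity p Γ m y
      = (fun z => K * (((a ⬝ᵥ B.mulVec z) + (1 / 2) * (a ⬝ᵥ a)) *
          Real.exp (-(1 / 2) * (B.mulVec z ⬝ᵥ B.mulVec z)))) (y - m) := by
    intro y
    have hyn : B.mulVec (y - n) = B.mulVec (y - m) + a := by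
      rw [ha, ← Matrix.mulVec_add]; congr 1; abel
    simp only [gaussDensity, hB, aux_bilin, hyn, ← hK]
    rw [mul_div_mul_left _ _ hKpos.ne', ← Real.exp_sub, Real.log_exp]
    simp only [dotProduct_add, add_dotProduct]
    rw [dotProduct_comm (B.mulVec (y - m)) a]
    ring
  simp_rw [key]
  rw [integral_sub_right_eq_self (fun z => K * (((a ⬝ᵥ B.mulVec z) + (1 / 2) * (a ⬝ᵥ a)) *
          Real.exp (-(1 / 2) * (B.mulVec z ⬝ᵥ B.mulVec z)))) m]
  rw [integral_const_mul, aux_cov hB0 (fun w => ((a ⬝ᵥ w) + (1 / 2) * (a ⬝ᵥ a)) *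
          Real.exp (-(1 / 2) * (w ⬝ᵥ w))) (by unfold dotProduct; fun_prop), aux_val]
  have hneg : B.mulVec (n - m) = -a := by rw [ha, ← Matrix.mulVec_neg]; congr 1; abel
  rw [hneg, neg_dotProduct, dotProduct_neg, neg_neg]
  linear_combination (1 / 2) * (a ⬝ᵥ a) * hKval

lemma aux_second {X : Type*} [NormedAddCommGroup X]
    [InnerProductSpace ℝ X] [MeasurableSpace X] [BorelSpace X]
    (μ₀ : Measure X) (u : X) (v : NNReal)
    (h : μ₀.map (fun x => ⟪u, x⟫) = gaussianReal 0 v) :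
    Integrable (fun x => ⟪u, x⟫ ^ 2) μ₀ ∧ ∫ x, ⟪u, x⟫ ^ 2 ∂μ₀ = v := by
  have hm : Measurable (fun x : X => ⟪u, x⟫) :=
    (continuous_const.inner continuous_id).measurable
  have hi : Integrable (fun t : ℝ => t ^ 2) (gaussianReal 0 v) :=
    (memLp_id_gaussianReal 2).integrable_sq
  have hv : ∫ t, t ^ 2 ∂(gaussianReal 0 v) = v := by
    have := variance_id_gaussianReal (μ := 0) (v := v)
    rw [variance_of_integral_eq_zero aemeasurable_id (by simp)] at this
    simpa using this
  rw [← h] at hi hv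
  constructor
  · exact hi.comp_measurable hm
  · rw [integral_map hm.aemeasurable (by fun_prop)] at hv
    exact hv

/-- for linear observation maps `G(x;d) = G(d)x`, `G_N(x;d) = G_N(d)x` from a
separable Hilbert space `X` to `ℝ^p`, a centered Gaussian prior `μ₀ = N(0, C₀)` (encoded by the
requirement that every one-dimensional projection `⟪u, X⟫` is `N(0, ⟪C₀u, u⟫)`) and Gaussian
noise `N(0, Γ)`, the prior-averaged KL divergence between the two likelihoods equals
`(1/2)‖Γ^{-1/2}(G(d) − G_N(d))C₀^{1/2}‖²_{HS}`, the squared Hilbert–Schmidt norm expressed via a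
self-adjoint square root `C₀half` of `C₀` and a Hilbert basis `b` of `X`. -/
theorem averaged_kl_linear_gaussian_HS {X : Type*} [NormedAddCommGroup X]
    [InnerProductSpace ℝ X] [MeasurableSpace X] [BorelSpace X]
    (μ₀ : Measure X) [IsProbabilityMeasure μ₀]
    (C₀ C₀half : X →L[ℝ] X)
    (hhalf : ∀ x, C₀half (C₀half x) = C₀ x)
    (hsa : ∀ x y : X, ⟪C₀half x, y⟫ = ⟪x, C₀half y⟫)
    (hGauss : ∀ u : X, μ₀.map (fun x => ⟪u, x⟫) = gaussianReal 0 (⟪C₀ u, u⟫).toNNReal)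
    (p : ℕ) (Γ : Matrix (Fin p) (Fin p) ℝ) (hΓ : Γ.PosDef)
    {D : Type*} (G GN : D → X →L[ℝ] (Fin p → ℝ)) (d : D)
    (b : HilbertBasis ℕ ℝ X) :
    (∫ x, (∫ y, Real.log (gaussDensity p Γ ((GN d) x) y / gaussDensity p Γ ((G d) x) y)
          * gaussDensity p Γ ((GN d) x) y) ∂μ₀)
      = (1 / 2) * ∑' n : ℕ,
          ((G d - GN d) (C₀half (b n))) ⬝ᵥ Γ⁻¹.mulVec ((G d - GN d) (C₀half (b n))) := by
  obtain ⟨B, hB⟩ := aux_factor hΓ.inv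
  have : CompleteSpace X := (completeSpace_congr (e := b.repr.toEquiv) b.repr.isometry.isUniformEmbedding).2 inferInstance
  simp_rw [aux_kl hΓ hB, hB, aux_bilin]
  let T : Fin p → X →L[ℝ] ℝ := fun i =>
    (ContinuousLinearMap.proj i).comp ((LinearMap.toContinuousLinearMap (toLin' B)).comp (G d - GN d))
  let u : Fin p → X := fun i => (InnerProductSpace.toDual ℝ X).symm (T i)
  have hu : ∀ i x, B.mulVec ((G d - GN d) x) i = ⟪u i, x⟫ := by
    intro i x
    simp only [u, InnerProductSpace.toDual_symm_apply]
    rfl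
  have hsq : ∀ x, B.mulVec ((G d - GN d) x) ⬝ᵥ B.mulVec ((G d - GN d) x)
      = ∑ i, ⟪u i, x⟫ ^ 2 := by
    intro x
    simp only [dotProduct, hu, sq]
  have hC : ∀ w : X, ⟪C₀ w, w⟫ = ⟪C₀half w, C₀half w⟫ := by
    intro w
    rw [← hhalf, hsa]
  have hs := fun i => aux_second μ₀ (u i) _ (hGauss (u i))
  have hL : ∀ x, G d x - GN d x = (G d - GN d) x := fun x => rfl
  simp_rw [hL, hsq]
  rw [integral_const_mul, integral_finsetSum _ (fun i _ => (hs i).1)]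
  congr 1
  symm
  apply HasSum.tsum_eq
  apply hasSum_sum
  intro i _
  rw [(hs i).2, hC, Real.coe_toNNReal _ real_inner_self_nonneg]
  have hfun : (fun n => ⟪u i, C₀half (b n)⟫ ^ 2)
      = fun n => ⟪C₀half (u i), b n⟫ * ⟪b n, C₀half (u i)⟫ := by
    funext n
    rw [real_inner_comm (C₀half (u i)) (b n), hsa, sq]
  rw [hfun]
  exact b.hasSum_inner_mul_inner (C₀half (u i)) (C₀half (u i))
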